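/- Let p : g → ℂ be a smooth function that is infinitesimally invariant (dp(x).[y,x] = 0 for all x, y ∈ g) and homogeneous of degree m ≥ 1 (p(t•x) = tᵐ·p(x) for all t ∈ ℂ, x ∈ g). If e ∈ g is such that there exists h ∈ g with [h, e] = 2e (for example, e a nilpotent element fitting into an sl(2)-triple), then p(e) = 0. -/

import Mathlib

/-- Euler's identity: a differentiable function homogeneous of degree `m` satisfies
`dp(x).x = m * p x`. -/
theorem fderiv_apply_self_of_homogeneous {E : Type*} [NormedAddCommGroup E] [NormedSpace ℂ E]
    {p : E → ℂ} {m : ℕ} {x : E} (hp : DifferentiableAt ℂ p x)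
    (hhom : ∀ t : ℂ, p (t • x) = t ^ m * p x) :
    fderiv ℂ p x x = m * p x := by
  have hline : HasDerivAt (fun t : ℂ => t • x) x 1 := by
    simpa using (hasDerivAt_id (1 : ℂ)).smul_const x
  have hcomp : HasDerivAt (fun t : ℂ => p (t • x)) (fderiv ℂ p x x) 1 :=
    HasFDerivAt.comp_hasDerivAt_of_eq 1 hp.hasFDerivAt hline (one_smul ℂ x).symm
  have hpow : HasDerivAt (fun t : ℂ => p (t • x)) (m * p x) 1 := by
    simpa [hhom] using (hasDerivAt_pow m (1 : ℂ)).mul_const (p x)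
  exact hcomp.unique hpow

theorem stmt {g : Type*} [NormedAddCommGroup g] [NormedSpace ℂ g] [FiniteDimensional ℂ g]
    -- `lie` is the Lie bracket of the finite-dimensional complex Lie algebra `g`,
    -- given as bilinear data so that it is compatible with the normed space structure.
    (lie : g →ₗ[ℂ] g →ₗ[ℂ] g)
    (lie_self : ∀ x : g, lie x x = 0)
    (lie_jacobi : ∀ x y z : g, lie x (lie y z) = lie (lie x y) z + lie y (lie x z))
    (p : g → ℂ) (hp : ContDiff ℂ ⊤ p)
    (hpinv : ∀ x y : g, fderiv ℂ p x (lie y x) = 0)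
    (m : ℕ) (hm : 1 ≤ m)
    (hhom : ∀ (t : ℂ) (x : g), p (t • x) = t ^ m * p x)
    (e : g) (he : ∃ h : g, lie h e = (2 : ℂ) • e) :
    p e = 0 := by
  obtain ⟨h, hh⟩ := he
  have hinv : fderiv ℂ p e e = 0 := by simpa [hh] using hpinv e h
  have heuler := fderiv_apply_self_of_homogeneous
    (hp.differentiable (by simp) e) (fun t => hhom t e)
  rw [hinv] at heuler
  exact (mul_eq_zero.mp heuler.symm).resolve_left (Nat.cast_ne_zero.mpr (by omega))
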